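/- Fix b with 0 < b < 4/7, n with 0 ≤ n < 1 − b/2, and a sign ε₀ ∈ {−1, +1}. Let u : ℝ × ℝ → ℝ be an admissible smooth solution on [2,∞) of the quartic KdV equation ∂_t u + ∂_x(∂_x² u + u⁴) = 0 with sup_{t≥2} (‖u(t,·)‖_{L²(ℝ)} + ‖∂_x u(t,·)‖_{L²(ℝ)}) < ∞. For t ≥ 2 set Ω(t) = { x ∈ ℝ : |x + ε₀ t^n| < t^b }. Then liminf_{t→∞} ∫_{Ω(t)} u(t,x)⁴ dx = 0. -/

import Mathlib

open MeasureTheory Filter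

noncomputable section

/-- Partial derivative in time of a function `u(t,x)`. -/
def pt1 (u : ℝ → ℝ → ℝ) : ℝ → ℝ → ℝ := fun t x => deriv (fun s => u s x) t

/-- Partial derivative in space of a function `u(t,x)`. -/
def px1 (u : ℝ → ℝ → ℝ) : ℝ → ℝ → ℝ := fun t x => deriv (fun a => u t a) x

/-- Iterated partial derivatives of `u(t,x)`, indexed by a list of directions
(`0` = t, `1` = x). -/
def D1 (u : ℝ → ℝ → ℝ) : List (Fin 2) → (ℝ → ℝ → ℝ)
  | [] => u
  | i :: l => if i = 0 then pt1 (D1 u l) else px1 (D1 u l)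

/-- An admissible smooth solution of the generalized KdV equation
`∂ₜu + ∂ₓ(∂ₓ²u + u^p) = 0` on `[2,∞)`: it is `C^∞`, solves the equation pointwise
for `t ≥ 2`, and all iterated partial derivatives decay in space faster than any
polynomial, locally uniformly in time. -/
structure IsAdmissibleGKdV (p : ℕ) (u : ℝ → ℝ → ℝ) : Prop where
  smooth : ContDiff ℝ (⊤ : ℕ∞) (fun q : ℝ × ℝ => u q.1 q.2)
  eqn : ∀ t x : ℝ, 2 ≤ t →
    pt1 u t x + px1 (fun t' x' => px1 (px1 u) t' x' + (u t' x') ^ p) t x = 0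
  decay : ∀ (l : List (Fin 2)) (N : ℕ) (a b : ℝ), 2 ≤ a →
    ∃ C : ℝ, ∀ t x : ℝ, t ∈ Set.Icc a b →
      (1 + |x|) ^ N * |D1 u l t x| ≤ C

/-- A smooth cutoff `χ` with its first two derivatives, and a bounded primitive `G` of `χ`. -/
structure Cutoff where
  χ : ℝ → ℝ
  χ₁ : ℝ → ℝ
  χ₂ : ℝ → ℝ
  G : ℝ → ℝ
  K : ℝ
  one_le_K : 1 ≤ K
  hasDerivAt_χ : ∀ y, HasDerivAt χ (χ₁ y) y
  hasDerivAt_χ₁ : ∀ y, HasDerivAt χ₁ (χ₂ y) y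
  hasDerivAt_G : ∀ y, HasDerivAt G (χ y) y
  continuous_χ₂ : Continuous χ₂
  χ_nonneg : ∀ y, 0 ≤ χ y
  χ_le_one : ∀ y, χ y ≤ 1
  χ_eq_one : ∀ y, |y| ≤ 1 → χ y = 1
  χ_eq_zero : ∀ y, 2 < |y| → χ y = 0
  χ₁_eq_zero : ∀ y, 2 < |y| → χ₁ y = 0
  χ₂_eq_zero : ∀ y, 2 < |y| → χ₂ y = 0
  abs_χ₁_le : ∀ y, |χ₁ y| ≤ K
  abs_χ₂_le : ∀ y, |χ₂ y| ≤ K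
  abs_G_le : ∀ y, |G y| ≤ K

lemma deriv_eq_zero_of_two_lt_abs {f : ℝ → ℝ} (hf : ∀ y, 2 < |y| → f y = 0) (y : ℝ)
    (hy : 2 < |y|) : deriv f y = 0 := by
  have : f =ᶠ[nhds y] fun _ => 0 := by
    filter_upwards [(isOpen_lt continuous_const continuous_abs).mem_nhds hy] with z hz
    exact hf z hz
  rw [this.deriv_eq]
  simp

lemma exists_abs_le_of_eq_zero {f : ℝ → ℝ} (hc : Continuous f)
    (hf : ∀ y, 2 < |y| → f y = 0) : ∃ C, ∀ y, |f y| ≤ C := by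
  refine HasCompactSupport.exists_bound_of_continuous
    (HasCompactSupport.intro (isCompact_Icc (a := (-2 : ℝ)) (b := 2)) fun x hx => hf x ?_) hc
  by_contra! h
  exact hx (abs_le.1 h)

lemma nonempty_cutoff : Nonempty Cutoff := by
  let f : ContDiffBump (0 : ℝ) := ⟨1, 2, one_pos, one_lt_two⟩
  have hf : ContDiff ℝ 2 f := f.contDiff
  have hf1 : ContDiff ℝ 1 (deriv f) := by
    have : ContDiff ℝ (1 + 1) f := by simpa [one_add_one_eq_two] using hf
    exact (contDiff_succ_iff_deriv.1 this).2.2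
  have hf2 : Continuous (deriv (deriv f)) := hf1.continuous_deriv le_rfl
  have h0 : ∀ y, 2 < |y| → f y = 0 := fun y hy => f.zero_of_le_dist (by simpa using hy.le)
  have h1 := deriv_eq_zero_of_two_lt_abs h0
  have h2 := deriv_eq_zero_of_two_lt_abs h1
  obtain ⟨C₁, hC₁⟩ := exists_abs_le_of_eq_zero hf1.continuous h1
  obtain ⟨C₂, hC₂⟩ := exists_abs_le_of_eq_zero hf2 h2
  have hint : Integrable (fun x => ‖f x‖) := (f.integrable (μ := volume)).norm
  refine ⟨⟨f, deriv f, deriv (deriv f), fun y => ∫ x in (0 : ℝ)..y, f x,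
    1 + |C₁| + |C₂| + ∫ x, ‖f x‖, ?_, fun y => ?_, fun y => ?_, fun y => ?_, hf2,
    fun y => f.nonneg, fun y => f.le_one,
    fun y hy => f.one_of_mem_closedBall (by simpa using hy), h0, h1, h2,
    fun y => ?_, fun y => ?_, fun y => ?_⟩⟩
  · have := integral_nonneg (μ := volume) (f := fun x => ‖f x‖) fun x => norm_nonneg _
    linarith [abs_nonneg C₁, abs_nonneg C₂]
  · exact (hf.differentiable (by norm_num) y).hasDerivAt
  · exact (hf1.differentiable (by norm_num) y).hasDerivAt
  · exact intervalIntegral.integral_hasDerivAt_right (f.continuous.intervalIntegrable _ _)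
      (f.continuous.stronglyMeasurableAtFilter _ _) f.continuous.continuousAt
  · have := integral_nonneg (μ := volume) (f := fun x => ‖f x‖) fun x => norm_nonneg _
    linarith [abs_nonneg C₁, abs_nonneg C₂, hC₁ y, le_abs_self C₁]
  · have := integral_nonneg (μ := volume) (f := fun x => ‖f x‖) fun x => norm_nonneg _
    linarith [abs_nonneg C₁, abs_nonneg C₂, hC₂ y, le_abs_self C₂]
  · have h3 := intervalIntegral.norm_integral_le_integral_norm_uIoc (f := f) (a := 0) (b := y)
      (μ := volume)
    have h4 := setIntegral_le_integral (s := Set.uIoc 0 y) hint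
      (Eventually.of_forall fun x => norm_nonneg _)
    rw [Real.norm_eq_abs] at h3
    linarith [abs_nonneg C₁, abs_nonneg C₂]

lemma integrable_of_abs_le_sq {f : ℝ → ℝ} (hf : Continuous f) {C : ℝ}
    (h : ∀ x, (1 + |x|) ^ 2 * |f x| ≤ C) : Integrable f := by
  refine (integrable_inv_one_add_sq.const_mul C).mono' hf.aestronglyMeasurable
    (Eventually.of_forall fun x => ?_)
  rw [Real.norm_eq_abs, ← div_eq_mul_inv, le_div_iff₀ (by positivity)]
  refine le_trans ?_ (h x)
  rw [mul_comm]
  refine mul_le_mul_of_nonneg_right ?_ (abs_nonneg _)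
  nlinarith [abs_nonneg x, sq_abs x]

lemma integrable_mul_of_abs_le {f g : ℝ → ℝ} (hf : Continuous f) (hg : Continuous g) {C D : ℝ}
    (hfC : ∀ x, (1 + |x|) * |f x| ≤ C) (hgD : ∀ x, (1 + |x|) * |g x| ≤ D) :
    Integrable fun x => f x * g x := by
  refine integrable_of_abs_le_sq (hf.mul hg) (C := C * D) fun x => ?_
  have := mul_le_mul (hfC x) (hgD x) (by positivity) (le_trans (by positivity) (hfC x))
  rw [abs_mul]
  linarith

/-- Agmon's inequality in a weak form. -/
lemma sq_le_integral_sq_add {v v' : ℝ → ℝ} (hv : ∀ x, HasDerivAt v (v' x) x)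
    (hv' : Continuous v') {C D : ℝ} (hC : ∀ x, (1 + |x|) * |v x| ≤ C)
    (hD : ∀ x, (1 + |x|) * |v' x| ≤ D) (x : ℝ) :
    v x ^ 2 ≤ (∫ y, v y ^ 2) + ∫ y, v' y ^ 2 := by
  have hvc : Continuous v := continuous_iff_continuousAt.2 fun x => (hv x).continuousAt
  have i1 : Integrable fun x => v x ^ 2 := by
    simpa [sq] using integrable_mul_of_abs_le hvc hvc hC hC
  have i2 : Integrable fun x => v' x ^ 2 := by
    simpa [sq] using integrable_mul_of_abs_le hv' hv' hD hD
  have i3 : Integrable fun x => 2 * (v x * v' x) :=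
    (integrable_mul_of_abs_le hvc hv' hC hD).const_mul 2
  have hd : ∀ x, HasDerivAt (fun x => v x ^ 2) (2 * (v x * v' x)) x := fun x => by
    refine ((hv x).fun_pow 2).congr_deriv ?_
    push_cast
    ring
  have hlim0 : Tendsto v atBot (nhds 0) := by
    have h1 : Tendsto (fun x : ℝ => C / (1 + |x|)) atBot (nhds 0) :=
      tendsto_const_nhds.div_atTop (tendsto_atTop_add_const_left _ _ tendsto_abs_atBot_atTop)
    refine squeeze_zero_norm (fun x => ?_) h1
    rw [Real.norm_eq_abs, le_div_iff₀ (by positivity)]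
    linarith [hC x]
  have hlim : Tendsto (fun x => v x ^ 2) atBot (nhds 0) := by simpa using hlim0.pow 2
  have key := integral_Iic_of_hasDerivAt_of_tendsto (a := x) (hd x).continuousAt.continuousWithinAt
    (fun y _ => hd y) i3.integrableOn hlim
  have i4 := i1.add i2
  rw [← integral_add i1 i2]
  calc v x ^ 2 = ∫ y in Set.Iic x, 2 * (v y * v' y) := by rw [key]; ring
    _ ≤ ∫ y in Set.Iic x, (v y ^ 2 + v' y ^ 2) :=
        setIntegral_mono i3.integrableOn i4.integrableOn fun y => by
          nlinarith [sq_nonneg (v y - v' y)]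
    _ ≤ _ := setIntegral_le_integral i4 (Eventually.of_forall fun y => by positivity)

/-- Pairing an `L²` function with a bounded function supported in an interval of half-length
`2 r ^ 2`. -/
lemma abs_integral_mul_le {v h : ℝ → ℝ} (hv : Integrable fun x => v x ^ 2) {A B c r : ℝ}
    (hr : 0 < r) (hB : ∫ x, v x ^ 2 ≤ B) (hA : ∀ x, |h x| ≤ A)
    (hs : ∀ x, 2 * r ^ 2 < |x - c| → h x = 0) :
    |∫ x, v x * h x| ≤ A * ((2 + B / 2) * r) := by
  have hA0 : 0 ≤ A := (abs_nonneg _).trans (hA 0)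
  set I : Set ℝ := Set.Icc (c - 2 * r ^ 2) (c + 2 * r ^ 2) with hI
  have hIm : MeasurableSet I := measurableSet_Icc
  have i1 : Integrable (I.indicator fun _ => A * (r⁻¹ / 2)) :=
    (integrable_indicator_iff hIm).2 (integrableOn_const (by simp [I]))
  have i2 : Integrable fun x => A * (r / 2) * v x ^ 2 := hv.const_mul _
  have hle := norm_integral_le_of_norm_le (f := fun x => v x * h x) (i1.add i2)
    (Eventually.of_forall fun x => by
      rw [Real.norm_eq_abs, abs_mul]
      by_cases hx : x ∈ I
      · simp only [Pi.add_apply, Set.indicator_of_mem hx]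
        have h1 : |v x| ≤ r⁻¹ / 2 + r / 2 * v x ^ 2 := by
          have h2 : 0 ≤ r⁻¹ / 2 * (1 - r * |v x|) ^ 2 := by positivity
          have h3 : r⁻¹ / 2 * (1 - r * |v x|) ^ 2 = r⁻¹ / 2 + r / 2 * v x ^ 2 - |v x| := by
            rw [← sq_abs (v x)]
            field_simp
            ring
          linarith
        calc |v x| * |h x| ≤ (r⁻¹ / 2 + r / 2 * v x ^ 2) * A := by gcongr; exact hA x
          _ = _ := by ring
      · have : h x = 0 := hs x (by
          by_contra! hc
          rw [abs_le] at hc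
          exact hx ⟨by linarith, by linarith⟩)
        simp only [Pi.add_apply, Set.indicator_of_notMem hx, this]
        simp only [abs_zero, mul_zero, zero_add]
        positivity)
  rw [Real.norm_eq_abs] at hle
  refine hle.trans ?_
  simp only [Pi.add_apply]
  rw [integral_add i1 i2, integral_indicator hIm, setIntegral_const]
  have hvol : volume.real I = 4 * r ^ 2 := by
    rw [hI, Real.volume_real_Icc_of_le (by nlinarith)]
    ring
  rw [hvol, smul_eq_mul]
  have : 4 * r ^ 2 * (A * (r⁻¹ / 2)) = A * (2 * r) := by
    field_simp
    ring
  have h2 : A * (r / 2) * ∫ x, v x ^ 2 ≤ A * (r / 2) * B := by gcongr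
  rw [← integral_const_mul] at h2
  linarith

/-- Differentiation under the integral sign for compactly supported integrands. -/
lemma hasDerivAt_integral_of_support {f f' : ℝ → ℝ → ℝ} {t δ R : ℝ} (hδ : 0 < δ)
    (hd : ∀ s ∈ Set.Icc (t - δ) (t + δ), ∀ x, HasDerivAt (fun s => f s x) (f' s x) s)
    (hc : ∀ s ∈ Set.Icc (t - δ) (t + δ), Continuous (f s))
    (hc' : ContinuousOn (fun q : ℝ × ℝ => f' q.1 q.2)
      (Set.Icc (t - δ) (t + δ) ×ˢ Set.univ))
    (hs : ∀ s ∈ Set.Icc (t - δ) (t + δ), ∀ x, R < |x| → f s x = 0)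
    (hs' : ∀ s ∈ Set.Icc (t - δ) (t + δ), ∀ x, R < |x| → f' s x = 0) :
    HasDerivAt (fun s => ∫ x, f s x) (∫ x, f' t x) t := by
  have hnb : Set.Icc (t - δ) (t + δ) ∈ nhds t := Icc_mem_nhds (by linarith) (by linarith)
  have htm : t ∈ Set.Icc (t - δ) (t + δ) := mem_of_mem_nhds hnb
  obtain ⟨C, hC⟩ :=
    (isCompact_Icc.prod (isCompact_Icc (a := -R) (b := R))).exists_bound_of_continuousOn
      (hc'.mono (Set.prod_mono subset_rfl (Set.subset_univ _)))
  have hi : Integrable (f t) := (hc t htm).integrable_of_hasCompactSupport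
    (HasCompactSupport.intro (isCompact_Icc (a := -R) (b := R)) fun x hx => hs t htm x (by
      by_contra! h
      exact hx (abs_le.1 h)))
  have hm : Continuous (f' t) := by
    have : ContinuousOn (f' t) Set.univ :=
      hc'.comp (f := fun x : ℝ => (t, x)) (by fun_prop) fun x _ => ⟨htm, trivial⟩
    exact continuousOn_univ.1 this
  refine (hasDerivAt_integral_of_dominated_loc_of_deriv_le (F := f) (F' := f')
    (bound := (Set.Icc (-R) R).indicator fun _ => C) hnb ?_ hi hm.aestronglyMeasurable ?_ ?_ ?_).2
  · filter_upwards [hnb] with s hs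
    exact (hc s hs).aestronglyMeasurable
  · refine Eventually.of_forall fun x s hsm => ?_
    by_cases hx : x ∈ Set.Icc (-R) R
    · rw [Set.indicator_of_mem hx]
      exact hC (s, x) ⟨hsm, hx⟩
    · rw [Set.indicator_of_notMem hx, hs' s hsm x (by
        by_contra! h
        exact hx (abs_le.1 h))]
      simp
  · exact (integrable_indicator_iff measurableSet_Icc).2 (by simp)
  · exact Eventually.of_forall fun x s hsm => hd s hsm x

lemma contDiff_px1 {u : ℝ → ℝ → ℝ} (hu : ContDiff ℝ (⊤ : ℕ∞) fun q : ℝ × ℝ => u q.1 q.2) :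
    ContDiff ℝ (⊤ : ℕ∞) fun q : ℝ × ℝ => px1 u q.1 q.2 := by
  have h : (fun q : ℝ × ℝ => px1 u q.1 q.2) =
      fun q => fderiv ℝ (fun q : ℝ × ℝ => u q.1 q.2) q (0, 1) := by
    ext ⟨t, x⟩
    have h1 := ((hu.differentiable (by simp)) (t, x)).hasFDerivAt
    have h2 : HasDerivAt (fun a : ℝ => (t, a)) ((0 : ℝ), (1 : ℝ)) x :=
      (hasDerivAt_const x t).prodMk (hasDerivAt_id x)
    exact (h1.comp_hasDerivAt x h2).deriv
  rw [h]
  exact (hu.fderiv_right (m := (⊤ : ℕ∞)) (by simp)).clm_apply contDiff_const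

lemma contDiff_pt1 {u : ℝ → ℝ → ℝ} (hu : ContDiff ℝ (⊤ : ℕ∞) fun q : ℝ × ℝ => u q.1 q.2) :
    ContDiff ℝ (⊤ : ℕ∞) fun q : ℝ × ℝ => pt1 u q.1 q.2 := by
  have h : (fun q : ℝ × ℝ => pt1 u q.1 q.2) =
      fun q => fderiv ℝ (fun q : ℝ × ℝ => u q.1 q.2) q (1, 0) := by
    ext ⟨t, x⟩
    have h1 := ((hu.differentiable (by simp)) (t, x)).hasFDerivAt
    have h2 : HasDerivAt (fun a : ℝ => (a, x)) ((1 : ℝ), (0 : ℝ)) t :=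
      (hasDerivAt_id t).prodMk (hasDerivAt_const t x)
    exact (h1.comp_hasDerivAt t h2).deriv
  rw [h]
  exact (hu.fderiv_right (m := (⊤ : ℕ∞)) (by simp)).clm_apply contDiff_const

lemma hasDerivAt_px1 {u : ℝ → ℝ → ℝ} (hu : ContDiff ℝ (⊤ : ℕ∞) fun q : ℝ × ℝ => u q.1 q.2)
    (t x : ℝ) : HasDerivAt (u t) (px1 u t x) x := by
  have : DifferentiableAt ℝ (fun a => (fun q : ℝ × ℝ => u q.1 q.2) (t, a)) x :=
    (hu.differentiable (by simp) (t, x)).comp x (by fun_prop)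
  exact this.hasDerivAt

lemma hasDerivAt_pt1 {u : ℝ → ℝ → ℝ} (hu : ContDiff ℝ (⊤ : ℕ∞) fun q : ℝ × ℝ => u q.1 q.2)
    (t x : ℝ) : HasDerivAt (fun s => u s x) (pt1 u t x) t := by
  have : DifferentiableAt ℝ (fun a => (fun q : ℝ × ℝ => u q.1 q.2) (a, x)) t :=
    (hu.differentiable (by simp) (t, x)).comp (f := fun a : ℝ => (a, x)) t (by fun_prop)
  exact this.hasDerivAt

lemma integral_mul_deriv_of_support {v v' w w' : ℝ → ℝ} (hv : ∀ x, HasDerivAt v (v' x) x)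
    (hw : ∀ x, HasDerivAt w (w' x) x) (hv' : Continuous v') (hw' : Continuous w') {R : ℝ}
    (hs : ∀ x, R < |x| → w x = 0) (hs' : ∀ x, R < |x| → w' x = 0) :
    ∫ x, v x * w' x = -∫ x, v' x * w x := by
  have hvc : Continuous v := continuous_iff_continuousAt.2 fun x => (hv x).continuousAt
  have hwc : Continuous w := continuous_iff_continuousAt.2 fun x => (hw x).continuousAt
  have key : ∀ f g : ℝ → ℝ, Continuous f → Continuous g → (∀ x, R < |x| → g x = 0) →
      Integrable (f * g) := fun f g hf hg h =>
    (hf.mul hg).integrable_of_hasCompactSupport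
      (HasCompactSupport.intro (isCompact_Icc (a := -R) (b := R)) fun x hx => by
        have : R < |x| := by
          by_contra! h
          exact hx (abs_le.1 h)
        simp [h x this])
  exact integral_mul_deriv_eq_deriv_mul_of_integrable (fun x _ => hv x) (fun x _ => hw x)
    (key v w' hvc hw' hs') (key v' w hv' hwc hs) (key v w hvc hwc hs)

/-- The equation tested against a compactly supported weight. -/
lemma integral_pt1_mul {u : ℝ → ℝ → ℝ} (hu : IsAdmissibleGKdV 4 u) {t : ℝ} (ht : 2 ≤ t)
    {w w₁ w₂ : ℝ → ℝ} (hw : ∀ x, HasDerivAt w (w₁ x) x) (hw₁ : ∀ x, HasDerivAt w₁ (w₂ x) x)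
    (hw₂ : Continuous w₂) {R : ℝ} (hs : ∀ x, R < |x| → w x = 0)
    (hs₁ : ∀ x, R < |x| → w₁ x = 0) (hs₂ : ∀ x, R < |x| → w₂ x = 0) :
    ∫ x, pt1 u t x * w x = (∫ x, u t x ^ 4 * w₁ x) - ∫ x, px1 u t x * w₂ x := by
  have s1 := contDiff_px1 hu.smooth
  have s2 := contDiff_px1 s1
  have s3 : Continuous fun x => px1 (px1 (px1 u)) t x :=
    (contDiff_px1 s2).continuous.comp (f := fun x : ℝ => (t, x)) (by fun_prop)
  have c2 : Continuous fun x => px1 (px1 u) t x :=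
    s2.continuous.comp (f := fun x : ℝ => (t, x)) (by fun_prop)
  have c1 : Continuous fun x => px1 u t x :=
    s1.continuous.comp (f := fun x : ℝ => (t, x)) (by fun_prop)
  have c0 : Continuous fun x => u t x :=
    hu.smooth.continuous.comp (f := fun x : ℝ => (t, x)) (by fun_prop)
  have hwc : Continuous w := continuous_iff_continuousAt.2 fun x => (hw x).continuousAt
  have hw₁c : Continuous w₁ := continuous_iff_continuousAt.2 fun x => (hw₁ x).continuousAt
  have hd : ∀ x, HasDerivAt (fun a => px1 (px1 u) t a + u t a ^ 4)
      (px1 (px1 (px1 u)) t x + 4 * u t x ^ 3 * px1 u t x) x := fun x => by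
    refine ((hasDerivAt_px1 s2 t x).fun_add
      ((hasDerivAt_px1 hu.smooth t x).fun_pow 4)).congr_deriv ?_
    norm_num
  have heq : ∀ x, pt1 u t x = -(px1 (px1 (px1 u)) t x + 4 * u t x ^ 3 * px1 u t x) := fun x => by
    have h1 := hu.eqn t x ht
    have h2 : px1 (fun t' x' => px1 (px1 u) t' x' + u t' x' ^ 4) t x = _ := (hd x).deriv
    rw [h2] at h1
    linarith
  have e1 := integral_mul_deriv_of_support hd hw (by fun_prop) hw₁c hs hs₁
  have e2 := integral_mul_deriv_of_support (hasDerivAt_px1 s1 t) hw₁ c2 hw₂ hs₁ hs₂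
  have i1 : ∀ f : ℝ → ℝ, Continuous f → Integrable fun x => f x * w₁ x := fun f hf =>
    (hf.mul hw₁c).integrable_of_hasCompactSupport
      (HasCompactSupport.intro (isCompact_Icc (a := -R) (b := R)) fun x hx => by
        have : R < |x| := by
          by_contra! h
          exact hx (abs_le.1 h)
        simp [hs₁ x this])
  have e3 : ∫ x, pt1 u t x * w x = ∫ x, (px1 (px1 u) t x + u t x ^ 4) * w₁ x := by
    rw [e1, ← integral_neg]
    congr 1
    ext x
    rw [heq x]
    ring
  rw [e3, e2, sub_neg_eq_add, add_comm, 
    ← integral_add (i1 _ c2) (i1 (fun x => u t x ^ 4) (c0.pow 4))]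
  congr 1
  ext x
  ring

lemma Cutoff.continuous_χ (c : Cutoff) : Continuous c.χ :=
  continuous_iff_continuousAt.2 fun y => (c.hasDerivAt_χ y).continuousAt

lemma Cutoff.continuous_χ₁ (c : Cutoff) : Continuous c.χ₁ :=
  continuous_iff_continuousAt.2 fun y => (c.hasDerivAt_χ₁ y).continuousAt

lemma Cutoff.continuous_G (c : Cutoff) : Continuous c.G :=
  continuous_iff_continuousAt.2 fun y => (c.hasDerivAt_G y).continuousAt

/-- The moving frame `(x + ε t ^ n) / t ^ e`. -/
def frame (ε n e t x : ℝ) : ℝ := (x + ε * t ^ n) * t ^ (-e)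

/-- The time derivative of `frame`. -/
def frameT (ε n e t x : ℝ) : ℝ := ε * (n * t ^ (n - 1)) * t ^ (-e) - e * frame ε n e t x * t⁻¹

lemma hasDerivAt_frame (ε n e t x : ℝ) : HasDerivAt (frame ε n e t) (t ^ (-e)) x := by
  have := ((hasDerivAt_id x).add_const (ε * t ^ n)).mul_const (t ^ (-e))
  rwa [one_mul] at this

lemma hasDerivAt_frame_time (ε n e x : ℝ) {t : ℝ} (ht : 0 < t) :
    HasDerivAt (fun s => frame ε n e s x) (frameT ε n e t x) t := by
  have h1 : HasDerivAt (fun s : ℝ => x + ε * s ^ n) (ε * (n * t ^ (n - 1))) t :=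
    ((Real.hasDerivAt_rpow_const (Or.inl ht.ne')).const_mul ε).const_add x
  refine (h1.fun_mul (Real.hasDerivAt_rpow_const (p := -e) (Or.inl ht.ne'))).congr_deriv ?_
  rw [frameT, frame, Real.rpow_sub_one ht.ne' (-e)]
  ring

lemma abs_frame (ε n e x : ℝ) {t : ℝ} (ht : 0 < t) :
    |frame ε n e t x| = |x + ε * t ^ n| * t ^ (-e) := by
  rw [frame, abs_mul, abs_of_pos (Real.rpow_pos_of_pos ht _)]

lemma lt_abs_frame {ε n e t x k : ℝ} (ht : 0 < t) (h : k * t ^ e < |x + ε * t ^ n|) :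
    k < |frame ε n e t x| := by
  rw [abs_frame _ _ _ _ ht, Real.rpow_neg ht.le, ← div_eq_mul_inv,
    lt_div_iff₀ (Real.rpow_pos_of_pos ht _)]
  exact h

lemma abs_frame_le_one {ε n e f t x : ℝ} (ht : 1 ≤ t) (hef : e ≤ f)
    (h : |x + ε * t ^ n| < t ^ e) : |frame ε n f t x| ≤ 1 := by
  have ht0 : 0 < t := by linarith
  rw [abs_frame _ _ _ _ ht0, Real.rpow_neg ht0.le, ← div_eq_mul_inv,
    div_le_one (Real.rpow_pos_of_pos ht0 _)]
  exact h.le.trans (Real.rpow_le_rpow_of_exponent_le ht hef)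

lemma two_lt_abs_frame {ε n e t x T : ℝ} (hε : |ε| = 1) (ht : 0 < t) (htT : t ≤ T) (hn : 0 ≤ n)
    (he : 0 ≤ e) (hx : T ^ n + 2 * T ^ e < |x|) : 2 < |frame ε n e t x| := by
  refine lt_abs_frame ht ?_
  have h1 : t ^ n ≤ T ^ n := Real.rpow_le_rpow ht.le htT hn
  have h2 : t ^ e ≤ T ^ e := Real.rpow_le_rpow ht.le htT he
  have h3 : |x| ≤ |x + ε * t ^ n| + |ε * t ^ n| := by
    simpa using abs_sub (x + ε * t ^ n) (ε * t ^ n)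
  rw [abs_mul ε, hε, one_mul, abs_of_pos (Real.rpow_pos_of_pos ht n)] at h3
  linarith

lemma abs_frameT_le {ε n b e t x : ℝ} (hε : |ε| = 1) (ht : 1 ≤ t) (hn : 0 ≤ n) (hn1 : n ≤ 1)
    (he : 0 ≤ e) (he1 : e ≤ 1) (hbe : b ≤ e) (hx : |frame ε n e t x| ≤ 2) :
    |frameT ε n e t x| ≤ t ^ (n - 1) * t ^ (-b) + 2 * t⁻¹ := by
  have ht0 : 0 < t := by linarith
  have p1 := Real.rpow_pos_of_pos ht0 (n - 1)
  have p2 := Real.rpow_pos_of_pos ht0 (-e)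
  have h2 : t ^ (-e) ≤ t ^ (-b) := Real.rpow_le_rpow_of_exponent_le ht (by linarith)
  rw [frameT]
  refine (abs_sub _ _).trans (add_le_add ?_ ?_)
  · rw [abs_mul, abs_mul, hε, abs_mul, abs_of_nonneg hn, abs_of_pos p1, abs_of_pos p2, one_mul]
    gcongr
    nlinarith
  · rw [abs_mul, abs_mul, abs_of_nonneg he, abs_of_pos (inv_pos.2 ht0)]
    gcongr
    nlinarith [abs_nonneg (frame ε n e t x)]

lemma continuousOn_rpow_fst (e : ℝ) :
    ContinuousOn (fun q : ℝ × ℝ => q.1 ^ e) (Set.Ioi 0 ×ˢ Set.univ) :=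
  continuousOn_fst.rpow_const fun _ hq => Or.inl (ne_of_gt hq.1)

lemma continuousOn_frame (ε n e : ℝ) :
    ContinuousOn (fun q : ℝ × ℝ => frame ε n e q.1 q.2) (Set.Ioi 0 ×ˢ Set.univ) :=
  (continuousOn_snd.add (continuousOn_const.mul (continuousOn_rpow_fst n))).mul
    (continuousOn_rpow_fst (-e))

lemma continuousOn_frameT (ε n e : ℝ) :
    ContinuousOn (fun q : ℝ × ℝ => frameT ε n e q.1 q.2) (Set.Ioi 0 ×ˢ Set.univ) :=
  ((continuousOn_const.mul (continuousOn_const.mul (continuousOn_rpow_fst (n - 1)))).mul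
    (continuousOn_rpow_fst (-e))).sub
    ((continuousOn_const.mul (continuousOn_frame ε n e)).mul
      (continuousOn_fst.inv₀ fun _ hq => ne_of_gt hq.1))

namespace Cutoff

variable (c : Cutoff) (ε n b a : ℝ)

/-- The weight, increasing at scale `t ^ b` and cut off at the larger scale `t ^ a`. -/
def W (t x : ℝ) : ℝ := c.G (frame ε n b t x) * c.χ (frame ε n a t x)

/-- The first space derivative of `W`. -/
def W₁ (t x : ℝ) : ℝ :=
  c.χ (frame ε n b t x) * t ^ (-b) * c.χ (frame ε n a t x) +
    c.G (frame ε n b t x) * (c.χ₁ (frame ε n a t x) * t ^ (-a))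

/-- The second space derivative of `W`. -/
def W₂ (t x : ℝ) : ℝ :=
  c.χ₁ (frame ε n b t x) * c.χ (frame ε n a t x) * (t ^ (-b) * t ^ (-b)) +
    2 * (c.χ (frame ε n b t x) * c.χ₁ (frame ε n a t x)) * (t ^ (-b) * t ^ (-a)) +
    c.G (frame ε n b t x) * c.χ₂ (frame ε n a t x) * (t ^ (-a) * t ^ (-a))

/-- The time derivative of `W`. -/
def Wt (t x : ℝ) : ℝ :=
  c.χ (frame ε n b t x) * frameT ε n b t x * c.χ (frame ε n a t x) +
    c.G (frame ε n b t x) * (c.χ₁ (frame ε n a t x) * frameT ε n a t x)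

lemma hasDerivAt_W (t x : ℝ) : HasDerivAt (c.W ε n b a t) (c.W₁ ε n b a t x) x :=
  ((c.hasDerivAt_G _).comp x (hasDerivAt_frame ε n b t x)).fun_mul
    ((c.hasDerivAt_χ _).comp x (hasDerivAt_frame ε n a t x))

lemma hasDerivAt_W₁ (t x : ℝ) : HasDerivAt (c.W₁ ε n b a t) (c.W₂ ε n b a t x) x := by
  have hb := hasDerivAt_frame ε n b t x
  have ha := hasDerivAt_frame ε n a t x
  refine (((((c.hasDerivAt_χ _).comp x hb).mul_const (t ^ (-b))).fun_mul
    ((c.hasDerivAt_χ _).comp x ha)).fun_add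
    (((c.hasDerivAt_G _).comp x hb).fun_mul
      (((c.hasDerivAt_χ₁ _).comp x ha).mul_const (t ^ (-a))))).congr_deriv ?_
  simp only [W₂, Function.comp_apply]
  ring

lemma hasDerivAt_W_time {t : ℝ} (ht : 0 < t) (x : ℝ) :
    HasDerivAt (fun s => c.W ε n b a s x) (c.Wt ε n b a t x) t :=
  ((c.hasDerivAt_G _).comp t (hasDerivAt_frame_time ε n b x ht)).fun_mul
    ((c.hasDerivAt_χ _).comp t (hasDerivAt_frame_time ε n a x ht))

lemma continuousOn_W :
    ContinuousOn (fun q : ℝ × ℝ => c.W ε n b a q.1 q.2) (Set.Ioi 0 ×ˢ Set.univ) :=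
  (c.continuous_G.comp_continuousOn (continuousOn_frame ε n b)).mul
    (c.continuous_χ.comp_continuousOn (continuousOn_frame ε n a))

lemma continuousOn_Wt :
    ContinuousOn (fun q : ℝ × ℝ => c.Wt ε n b a q.1 q.2) (Set.Ioi 0 ×ˢ Set.univ) :=
  (((c.continuous_χ.comp_continuousOn (continuousOn_frame ε n b)).mul
    (continuousOn_frameT ε n b)).mul
      (c.continuous_χ.comp_continuousOn (continuousOn_frame ε n a))).add
    ((c.continuous_G.comp_continuousOn (continuousOn_frame ε n b)).mul
      ((c.continuous_χ₁.comp_continuousOn (continuousOn_frame ε n a)).mul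
        (continuousOn_frameT ε n a)))

lemma continuous_W (t : ℝ) : Continuous (c.W ε n b a t) :=
  continuous_iff_continuousAt.2 fun x => (c.hasDerivAt_W ε n b a t x).continuousAt

lemma continuous_W₁ (t : ℝ) : Continuous (c.W₁ ε n b a t) :=
  continuous_iff_continuousAt.2 fun x => (c.hasDerivAt_W₁ ε n b a t x).continuousAt

lemma continuous_W₂ (t : ℝ) : Continuous (c.W₂ ε n b a t) := by
  have h : ∀ e, Continuous (frame ε n e t) := fun e =>
    continuous_iff_continuousAt.2 fun x => (hasDerivAt_frame ε n e t x).continuousAt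
  have h1 := c.continuous_χ
  have h2 := c.continuous_χ₁
  have h3 := c.continuous_χ₂
  have h4 := c.continuous_G
  have ha := h a
  have hb := h b
  unfold W₂
  fun_prop

variable {ε n b a} {t x : ℝ}

lemma W_eq_zero (h : 2 < |frame ε n a t x|) : c.W ε n b a t x = 0 := by
  simp [W, c.χ_eq_zero _ h]

lemma W₁_eq_zero (h : 2 < |frame ε n a t x|) : c.W₁ ε n b a t x = 0 := by
  simp [W₁, c.χ_eq_zero _ h, c.χ₁_eq_zero _ h]

lemma W₂_eq_zero (h : 2 < |frame ε n a t x|) : c.W₂ ε n b a t x = 0 := by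
  simp [W₂, c.χ_eq_zero _ h, c.χ₁_eq_zero _ h, c.χ₂_eq_zero _ h]

lemma Wt_eq_zero (h : 2 < |frame ε n a t x|) : c.Wt ε n b a t x = 0 := by
  simp [Wt, c.χ_eq_zero _ h, c.χ₁_eq_zero _ h]

lemma abs_χ_le (y : ℝ) : |c.χ y| ≤ 1 := by
  rw [abs_of_nonneg (c.χ_nonneg y)]
  exact c.χ_le_one y

lemma abs_W_le : |c.W ε n b a t x| ≤ c.K := by
  have := c.one_le_K
  rw [W, abs_mul, ← mul_one c.K]
  exact mul_le_mul (c.abs_G_le _) (c.abs_χ_le _) (abs_nonneg _) (by linarith)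

lemma neg_le_W₁ (ht : 0 < t) : -(c.K ^ 2 * t ^ (-a)) ≤ c.W₁ ε n b a t x := by
  have hK := c.one_le_K
  have p1 := Real.rpow_pos_of_pos ht (-a)
  have p2 := Real.rpow_pos_of_pos ht (-b)
  have h1 : |c.G (frame ε n b t x) * (c.χ₁ (frame ε n a t x) * t ^ (-a))| ≤ c.K ^ 2 * t ^ (-a) := by
    rw [abs_mul, abs_mul, abs_of_pos p1, sq, mul_assoc]
    gcongr
    · exact c.abs_G_le _
    · exact c.abs_χ₁_le _
  have h2 : 0 ≤ c.χ (frame ε n b t x) * t ^ (-b) * c.χ (frame ε n a t x) :=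
    mul_nonneg (mul_nonneg (c.χ_nonneg _) p2.le) (c.χ_nonneg _)
  rw [W₁]
  linarith [neg_abs_le (c.G (frame ε n b t x) * (c.χ₁ (frame ε n a t x) * t ^ (-a)))]

lemma le_W₁ (ht : 1 ≤ t) (hba : b ≤ a) (hx : |x + ε * t ^ n| < t ^ b) :
    t ^ (-b) - c.K ^ 2 * t ^ (-a) ≤ c.W₁ ε n b a t x := by
  have ht0 : 0 < t := by linarith
  have hK := c.one_le_K
  have p1 := Real.rpow_pos_of_pos ht0 (-a)
  have h1 : |c.G (frame ε n b t x) * (c.χ₁ (frame ε n a t x) * t ^ (-a))| ≤ c.K ^ 2 * t ^ (-a) := by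
    rw [abs_mul, abs_mul, abs_of_pos p1, sq, mul_assoc]
    gcongr
    · exact c.abs_G_le _
    · exact c.abs_χ₁_le _
  rw [W₁, c.χ_eq_one _ (abs_frame_le_one ht le_rfl hx), c.χ_eq_one _ (abs_frame_le_one ht hba hx)]
  linarith [neg_abs_le (c.G (frame ε n b t x) * (c.χ₁ (frame ε n a t x) * t ^ (-a)))]

lemma abs_W₂_le (ht : 1 ≤ t) (hba : b ≤ a) :
    |c.W₂ ε n b a t x| ≤ 4 * c.K ^ 2 * (t ^ (-b) * t ^ (-b)) := by
  have ht0 : 0 < t := by linarith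
  have hK := c.one_le_K
  have p1 := Real.rpow_pos_of_pos ht0 (-a)
  have p2 := Real.rpow_pos_of_pos ht0 (-b)
  have h2 : t ^ (-a) ≤ t ^ (-b) := Real.rpow_le_rpow_of_exponent_le ht (by linarith)
  have h3 : |c.χ₁ (frame ε n b t x) * c.χ (frame ε n a t x) * (t ^ (-b) * t ^ (-b))| ≤
      c.K * 1 * (t ^ (-b) * t ^ (-b)) := by
    rw [abs_mul, abs_mul, abs_of_pos (mul_pos p2 p2)]
    gcongr
    · exact c.abs_χ₁_le _
    · exact c.abs_χ_le _
  have h4 : |2 * (c.χ (frame ε n b t x) * c.χ₁ (frame ε n a t x)) * (t ^ (-b) * t ^ (-a))| ≤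
      2 * (1 * c.K) * (t ^ (-b) * t ^ (-b)) := by
    rw [abs_mul, abs_mul, abs_mul, abs_of_pos (mul_pos p2 p1), abs_two]
    gcongr
    · exact c.abs_χ_le _
    · exact c.abs_χ₁_le _
  have h5 : |c.G (frame ε n b t x) * c.χ₂ (frame ε n a t x) * (t ^ (-a) * t ^ (-a))| ≤
      c.K * c.K * (t ^ (-b) * t ^ (-b)) := by
    rw [abs_mul, abs_mul, abs_of_pos (mul_pos p1 p1)]
    gcongr
    · exact c.abs_G_le _
    · exact c.abs_χ₂_le _
  rw [W₂]
  refine (abs_add_three _ _ _).trans ((add_le_add (add_le_add h3 h4) h5).trans ?_)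
  rw [← add_mul, ← add_mul]
  gcongr
  nlinarith

lemma abs_Wt_le (hε : |ε| = 1) (ht : 1 ≤ t) (hn : 0 ≤ n) (hn1 : n ≤ 1) (hb : 0 ≤ b)
    (hba : b ≤ a) (ha : a ≤ 1) :
    |c.Wt ε n b a t x| ≤ 2 * c.K ^ 2 * (t ^ (n - 1) * t ^ (-b) + 2 * t⁻¹) := by
  have ht0 : 0 < t := by linarith
  have hK := c.one_le_K
  have p1 := Real.rpow_pos_of_pos ht0 (n - 1)
  have p2 := Real.rpow_pos_of_pos ht0 (-b)
  set q := t ^ (n - 1) * t ^ (-b) + 2 * t⁻¹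
  have hq0 : 0 ≤ q := by positivity
  have h1 : |c.χ (frame ε n b t x) * frameT ε n b t x| ≤ q := by
    by_cases h : 2 < |frame ε n b t x|
    · simpa [c.χ_eq_zero _ h] using hq0
    · rw [abs_mul, ← one_mul q]
      exact mul_le_mul (c.abs_χ_le _) (abs_frameT_le hε ht hn hn1 hb (hba.trans ha) le_rfl
        (not_lt.1 h)) (abs_nonneg _) zero_le_one
  have h2 : |c.χ₁ (frame ε n a t x) * frameT ε n a t x| ≤ c.K * q := by
    by_cases h : 2 < |frame ε n a t x|
    · rw [c.χ₁_eq_zero _ h, zero_mul, abs_zero]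
      positivity
    · rw [abs_mul]
      exact mul_le_mul (c.abs_χ₁_le _) (abs_frameT_le hε ht hn hn1 (hb.trans hba) ha hba
        (not_lt.1 h)) (abs_nonneg _) (by linarith)
  have h3 : |c.χ (frame ε n b t x) * frameT ε n b t x * c.χ (frame ε n a t x)| ≤ q * 1 := by
    rw [abs_mul]
    exact mul_le_mul h1 (c.abs_χ_le _) (abs_nonneg _) hq0
  have h4 : |c.G (frame ε n b t x) * (c.χ₁ (frame ε n a t x) * frameT ε n a t x)| ≤
      c.K * (c.K * q) := by
    rw [abs_mul]
    exact mul_le_mul (c.abs_G_le _) h2 (abs_nonneg _) (by linarith)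
  rw [Wt]
  refine (abs_add_le _ _).trans ((add_le_add h3 h4).trans ?_)
  nlinarith [mul_nonneg hq0 (by nlinarith : (0 : ℝ) ≤ c.K ^ 2 - 1)]

end Cutoff

namespace IsAdmissibleGKdV

variable {u : ℝ → ℝ → ℝ} {t : ℝ}

lemma continuous_space (hu : IsAdmissibleGKdV 4 u) (t : ℝ) : Continuous (u t) :=
  hu.smooth.continuous.comp (f := fun x : ℝ => (t, x)) (by fun_prop)

lemma continuous_px1 (hu : IsAdmissibleGKdV 4 u) (t : ℝ) : Continuous (px1 u t) :=
  (contDiff_px1 hu.smooth).continuous.comp (f := fun x : ℝ => (t, x)) (by fun_prop)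

lemma exists_decay (hu : IsAdmissibleGKdV 4 u) (ht : 2 ≤ t) :
    ∃ C, ∀ x, (1 + |x|) * |u t x| ≤ C := by
  obtain ⟨C, hC⟩ := hu.decay [] 1 t t ht
  exact ⟨C, fun x => by simpa [D1] using hC t x ⟨le_rfl, le_rfl⟩⟩

lemma exists_decay_px1 (hu : IsAdmissibleGKdV 4 u) (ht : 2 ≤ t) :
    ∃ C, ∀ x, (1 + |x|) * |px1 u t x| ≤ C := by
  obtain ⟨C, hC⟩ := hu.decay [1] 1 t t ht
  exact ⟨C, fun x => by simpa [D1] using hC t x ⟨le_rfl, le_rfl⟩⟩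

lemma integrable_sq (hu : IsAdmissibleGKdV 4 u) (ht : 2 ≤ t) : Integrable fun x => u t x ^ 2 := by
  obtain ⟨C, hC⟩ := hu.exists_decay ht
  simpa [sq] using integrable_mul_of_abs_le (hu.continuous_space t) (hu.continuous_space t) hC hC

lemma integrable_px1_sq (hu : IsAdmissibleGKdV 4 u) (ht : 2 ≤ t) :
    Integrable fun x => px1 u t x ^ 2 := by
  obtain ⟨C, hC⟩ := hu.exists_decay_px1 ht
  simpa [sq] using integrable_mul_of_abs_le (hu.continuous_px1 t) (hu.continuous_px1 t) hC hC

lemma integrable_pow_four (hu : IsAdmissibleGKdV 4 u) (ht : 2 ≤ t) :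
    Integrable fun x => u t x ^ 4 := by
  obtain ⟨C, hC⟩ := hu.exists_decay ht
  have h : ∀ x, (1 + |x|) * |u t x ^ 2| ≤ C * C := fun x => by
    have h1 : |u t x| ≤ C := by nlinarith [hC x, abs_nonneg x, abs_nonneg (u t x)]
    rw [abs_pow, sq, ← mul_assoc]
    exact mul_le_mul (hC x) h1 (abs_nonneg _) ((abs_nonneg _).trans h1)
  have hc := hu.continuous_space t
  have := integrable_mul_of_abs_le (hc.pow 2) (hc.pow 2) h h
  refine this.congr (Eventually.of_forall fun x => ?_)
  simp only [Pi.pow_apply]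
  ring

lemma integral_pow_four_le (hu : IsAdmissibleGKdV 4 u) (ht : 2 ≤ t) {B : ℝ}
    (h0 : ∫ x, u t x ^ 2 ≤ B) (h1 : ∫ x, px1 u t x ^ 2 ≤ B) :
    ∫ x, u t x ^ 4 ≤ 2 * B * B := by
  obtain ⟨C, hC⟩ := hu.exists_decay ht
  obtain ⟨D, hD⟩ := hu.exists_decay_px1 ht
  have hB : 0 ≤ B := (integral_nonneg fun x => sq_nonneg (u t x)).trans h0
  have hsup : ∀ x, u t x ^ 2 ≤ 2 * B := fun x => by
    linarith [sq_le_integral_sq_add (hasDerivAt_px1 hu.smooth t) (hu.continuous_px1 t) hC hD x]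
  calc ∫ x, u t x ^ 4 ≤ ∫ x, 2 * B * u t x ^ 2 :=
        integral_mono (hu.integrable_pow_four ht) ((hu.integrable_sq ht).const_mul _) fun x => by
          nlinarith [hsup x, sq_nonneg (u t x)]
    _ ≤ 2 * B * B := by
        rw [integral_const_mul]
        gcongr

end IsAdmissibleGKdV

lemma integral_mul_W₁_ge (c : Cutoff) {ε n b a t B : ℝ} {f : ℝ → ℝ} (hf : Integrable f)
    (hf0 : ∀ x, 0 ≤ f x) (hB : ∫ x, f x ≤ B) (ht : 1 ≤ t) (hba : b ≤ a)
    (hi : Integrable fun x => f x * c.W₁ ε n b a t x) :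
    t ^ (-b) * (∫ x in {x : ℝ | |x + ε * t ^ n| < t ^ b}, f x) - c.K ^ 2 * t ^ (-a) * B ≤
      ∫ x, f x * c.W₁ ε n b a t x := by
  have ht0 : 0 < t := by linarith
  set S := {x : ℝ | |x + ε * t ^ n| < t ^ b}
  have hS : MeasurableSet S :=
    (isOpen_lt (continuous_abs.comp (continuous_id.add continuous_const))
      continuous_const).measurableSet
  have p := Real.rpow_pos_of_pos ht0 (-a)
  have i1 : Integrable (S.indicator fun x => t ^ (-b) * f x) := (hf.const_mul _).indicator hS
  have i2 : Integrable fun x => c.K ^ 2 * t ^ (-a) * f x := hf.const_mul _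
  calc _ ≤ t ^ (-b) * (∫ x in S, f x) - c.K ^ 2 * t ^ (-a) * ∫ x, f x := by gcongr
    _ = ∫ x, (S.indicator (fun x => t ^ (-b) * f x) x - c.K ^ 2 * t ^ (-a) * f x) := by
        rw [integral_sub i1 i2, integral_indicator hS, integral_const_mul, integral_const_mul]
    _ ≤ _ := integral_mono (i1.sub i2) hi fun x => by
        by_cases hx : x ∈ S
        · simp only [Set.indicator_of_mem hx]
          nlinarith [mul_le_mul_of_nonneg_left (c.le_W₁ (n := n) (ε := ε) ht hba hx) (hf0 x)]
        · simp only [Set.indicator_of_notMem hx]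
          nlinarith [mul_le_mul_of_nonneg_left (c.neg_le_W₁ (n := n) (ε := ε) (b := b) (a := a)
            (x := x) ht0) (hf0 x)]

/-- The virial estimate: the derivative of the weighted mean controls the local `L⁴` norm. -/
lemma exists_hasDerivAt_integral_mul_W {u : ℝ → ℝ → ℝ} (hu : IsAdmissibleGKdV 4 u) (c : Cutoff)
    {ε n b a t B : ℝ} (hε : |ε| = 1) (ht : 2 ≤ t) (hn : 0 ≤ n) (hn1 : n ≤ 1) (hb : 0 ≤ b)
    (hba : b ≤ a) (ha : a ≤ 1) (h0 : ∫ x, u t x ^ 2 ≤ B) (h1 : ∫ x, px1 u t x ^ 2 ≤ B) :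
    ∃ D, HasDerivAt (fun s => ∫ x, u s x * c.W ε n b a s x) D t ∧
      t ^ (-b) * (∫ x in {x : ℝ | |x + ε * t ^ n| < t ^ b}, u t x ^ 4) -
        (c.K ^ 2 * t ^ (-a) * (2 * B * B) +
          4 * c.K ^ 2 * (t ^ (-b) * t ^ (-b)) * ((2 + B / 2) * t ^ (a / 2)) +
          2 * c.K ^ 2 * (t ^ (n - 1) * t ^ (-b) + 2 * t⁻¹) * ((2 + B / 2) * t ^ (a / 2))) ≤ D := by
  have ht0 : 0 < t := by linarith
  have ht1 : 1 ≤ t := by linarith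
  have ha0 : 0 ≤ a := hb.trans hba
  set R := (t + 1) ^ n + 2 * (t + 1) ^ a
  have hfar : ∀ s ∈ Set.Icc (t - 1) (t + 1), ∀ x, R < |x| → 2 < |frame ε n a s x| :=
    fun s hs x hx => two_lt_abs_frame hε (by linarith [hs.1]) hs.2 hn ha0 hx
  have hsub : Set.Icc (t - 1) (t + 1) ×ˢ (Set.univ : Set ℝ) ⊆ Set.Ioi 0 ×ˢ Set.univ :=
    Set.prod_mono (fun s hs => by
      have := hs.1
      simp only [Set.mem_Ioi]
      linarith) subset_rfl
  have htm : t ∈ Set.Icc (t - 1) (t + 1) := ⟨by linarith, by linarith⟩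
  have cs : ∀ f g : ℝ → ℝ, Continuous f → Continuous g → (∀ x, R < |x| → g x = 0) →
      Integrable fun x => f x * g x := fun f g hf hg h =>
    (hf.mul hg).integrable_of_hasCompactSupport
      (HasCompactSupport.intro (isCompact_Icc (a := -R) (b := R)) fun x hx => by
        have : R < |x| := by
          by_contra! h
          exact hx (abs_le.1 h)
        simp [h x this])
  have cu := hu.continuous_space t
  have cWt : Continuous (c.Wt ε n b a t) :=
    continuousOn_univ.1 (((c.continuousOn_Wt ε n b a).mono hsub).comp (f := fun x : ℝ => (t, x))
      (by fun_prop) fun x _ => ⟨htm, trivial⟩)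
  have cpt : Continuous (pt1 u t) :=
    (contDiff_pt1 hu.smooth).continuous.comp (f := fun x : ℝ => (t, x)) (by fun_prop)
  have hderiv := hasDerivAt_integral_of_support (t := t) (R := R)
    (f := fun s x => u s x * c.W ε n b a s x)
    (f' := fun s x => pt1 u s x * c.W ε n b a s x + u s x * c.Wt ε n b a s x) one_pos
    (fun s hs x => (hasDerivAt_pt1 hu.smooth s x).fun_mul
      (c.hasDerivAt_W_time ε n b a (by linarith [hs.1]) x))
    (fun s _ => (hu.continuous_space s).mul (c.continuous_W ε n b a s))
    (((contDiff_pt1 hu.smooth).continuous.continuousOn.mul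
      ((c.continuousOn_W ε n b a).mono hsub)).add
      (hu.smooth.continuous.continuousOn.mul ((c.continuousOn_Wt ε n b a).mono hsub)))
    (fun s hs x hx => by simp [c.W_eq_zero (hfar s hs x hx)])
    (fun s hs x hx => by simp [c.W_eq_zero (hfar s hs x hx), c.Wt_eq_zero (hfar s hs x hx)])
  refine ⟨_, hderiv, ?_⟩
  rw [integral_add (cs _ _ cpt (c.continuous_W ε n b a t)
    fun x hx => c.W_eq_zero (hfar t htm x hx)) (cs _ _ cu cWt
    fun x hx => c.Wt_eq_zero (hfar t htm x hx)),
    integral_pt1_mul hu ht (c.hasDerivAt_W ε n b a t) (c.hasDerivAt_W₁ ε n b a t)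
      (c.continuous_W₂ ε n b a t) (fun x hx => c.W_eq_zero (hfar t htm x hx))
      (fun x hx => c.W₁_eq_zero (hfar t htm x hx)) (fun x hx => c.W₂_eq_zero (hfar t htm x hx))]
  have e1 := integral_mul_W₁_ge c (ε := ε) (n := n) (hu.integrable_pow_four ht)
    (fun x => by positivity) (hu.integral_pow_four_le ht h0 h1) ht1 hba
    (cs _ _ (cu.pow 4) (c.continuous_W₁ ε n b a t) fun x hx => c.W₁_eq_zero (hfar t htm x hx))
  have hr : 0 < t ^ (a / 2) := Real.rpow_pos_of_pos ht0 _
  have hr2 : (t ^ (a / 2)) ^ 2 = t ^ a := by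
    rw [← Real.rpow_natCast, ← Real.rpow_mul ht0.le]
    norm_num
  have hloc : ∀ x, 2 * (t ^ (a / 2)) ^ 2 < |x - -(ε * t ^ n)| → 2 < |frame ε n a t x| :=
    fun x hx => lt_abs_frame ht0 (by rwa [hr2, sub_neg_eq_add] at hx)
  have e2 := abs_integral_mul_le (hu.integrable_px1_sq ht) hr h1
    (fun x => c.abs_W₂_le (ε := ε) (n := n) ht1 hba) fun x hx => c.W₂_eq_zero (hloc x hx)
  have e3 := abs_integral_mul_le (hu.integrable_sq ht) hr h0
    (fun x => c.abs_Wt_le hε ht1 hn hn1 hb hba ha) fun x hx => c.Wt_eq_zero (hloc x hx)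
  linarith [le_abs_self (∫ x, px1 u t x * c.W₂ ε n b a t x),
    neg_abs_le (∫ x, u t x * c.Wt ε n b a t x)]

lemma abs_integral_mul_W_le {u : ℝ → ℝ → ℝ} (hu : IsAdmissibleGKdV 4 u) (c : Cutoff)
    {ε n b a t B : ℝ} (ht : 2 ≤ t) (h0 : ∫ x, u t x ^ 2 ≤ B) :
    |∫ x, u t x * c.W ε n b a t x| ≤ c.K * ((2 + B / 2) * t ^ (a / 2)) := by
  have ht0 : 0 < t := by linarith
  have hr2 : (t ^ (a / 2)) ^ 2 = t ^ a := by
    rw [← Real.rpow_natCast, ← Real.rpow_mul ht0.le]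
    norm_num
  exact abs_integral_mul_le (hu.integrable_sq ht) (Real.rpow_pos_of_pos ht0 _) h0
    (c := -(ε * t ^ n)) (fun x => c.abs_W_le) fun x hx => c.W_eq_zero
      (lt_abs_frame ht0 (by rwa [hr2, sub_neg_eq_add] at hx))

/-- A function growing at most like `t ^ p` cannot have derivative eventually bounded below by a
positive multiple of `t ^ (q - 1)` with `p < q`. -/
lemma not_eventually_hasDerivAt_ge {M : ℝ → ℝ} {k p q C : ℝ} (hk : 0 < k) (hp : 0 < p) (hpq : p < q)
    (hM : ∀ᶠ t in atTop, |M t| ≤ C * t ^ p) :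
    ¬ ∀ᶠ t in atTop, ∃ D, HasDerivAt M D t ∧ k * t ^ (q - 1) ≤ D := by
  intro hD
  have hq : 0 < q := hp.trans hpq
  obtain ⟨T, hT⟩ := eventually_atTop.1 (hD.and (eventually_gt_atTop 0))
  have hd : ∀ t ∈ Set.Ici T, ∃ D, HasDerivAt (fun t => M t - k / q * t ^ q) D t ∧ 0 ≤ D := by
    intro t ht
    obtain ⟨⟨D, h1, h2⟩, h3⟩ := hT t ht
    refine ⟨_, h1.fun_sub ((Real.hasDerivAt_rpow_const (p := q)
      (Or.inl h3.ne')).const_mul (k / q)), ?_⟩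
    have : k / q * (q * t ^ (q - 1)) = k * t ^ (q - 1) := by field_simp
    linarith
  have hmono : MonotoneOn (fun t => M t - k / q * t ^ q) (Set.Ici T) := by
    refine monotoneOn_of_deriv_nonneg (convex_Ici T) (fun t ht => ?_) (fun t ht => ?_)
      fun t ht => ?_
    · obtain ⟨D, h, _⟩ := hd t ht
      exact h.continuousAt.continuousWithinAt
    · obtain ⟨D, h, _⟩ := hd t (interior_subset ht)
      exact h.differentiableAt.differentiableWithinAt
    · obtain ⟨D, h, h'⟩ := hd t (interior_subset ht)
      rw [h.deriv]
      exact h'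
  set m := M T - k / q * T ^ q
  have hlim : Tendsto (fun t : ℝ => t ^ p * (k / q * t ^ (q - p) - C)) atTop atTop :=
    (tendsto_rpow_atTop hp).atTop_mul_atTop₀ (tendsto_atTop_add_const_right _ _
      ((tendsto_rpow_atTop (sub_pos.2 hpq)).const_mul_atTop (by positivity)))
  obtain ⟨t, h1, h2, h3, h4⟩ := (hM.and ((hlim.eventually_gt_atTop (-m)).and
    ((eventually_ge_atTop T).and (eventually_gt_atTop 0)))).exists
  have h5 : m ≤ M t - k / q * t ^ q := hmono Set.self_mem_Ici h3 h3
  have h6 : t ^ q = t ^ p * t ^ (q - p) := by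
    rw [← Real.rpow_add h4]
    congr 1
    ring
  rw [h6] at h5
  have h7 := le_abs_self (M t)
  linarith

lemma tendsto_error {n b a : ℝ} (K B : ℝ) (h1 : b < a) (h2 : a < 2 * b) (h3 : a < 2 - 2 * n)
    (h4 : a < 2 - 2 * b) :
    Tendsto (fun t : ℝ => t ^ b * (K ^ 2 * t ^ (-a) * (2 * B * B) +
          4 * K ^ 2 * (t ^ (-b) * t ^ (-b)) * ((2 + B / 2) * t ^ (a / 2)) +
          2 * K ^ 2 * (t ^ (n - 1) * t ^ (-b) + 2 * t⁻¹) * ((2 + B / 2) * t ^ (a / 2))))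
      atTop (nhds 0) := by
  have l1 := (tendsto_rpow_neg_atTop (sub_pos.2 h1)).const_mul (K ^ 2 * (2 * B * B))
  have l2 := (tendsto_rpow_neg_atTop (y := b - a / 2) (by linarith)).const_mul
    (4 * K ^ 2 * (2 + B / 2))
  have l3 := (tendsto_rpow_neg_atTop (y := 1 - n - a / 2) (by linarith)).const_mul
    (2 * K ^ 2 * (2 + B / 2))
  have l4 := (tendsto_rpow_neg_atTop (y := 1 - b - a / 2) (by linarith)).const_mul
    (4 * K ^ 2 * (2 + B / 2))
  have l := ((l1.add l2).add l3).add l4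
  simp only [mul_zero, add_zero] at l
  refine l.congr' ?_
  filter_upwards [eventually_gt_atTop 0] with t ht
  have e1 : t ^ (-(a - b)) = t ^ b * t ^ (-a) := by
    rw [← Real.rpow_add ht]
    ring_nf
  have e2 : t ^ (-(b - a / 2)) = t ^ b * (t ^ (-b) * t ^ (-b) * t ^ (a / 2)) := by
    simp only [← Real.rpow_add ht]
    ring_nf
  have e3 : t ^ (-(1 - n - a / 2)) = t ^ b * (t ^ (n - 1) * t ^ (-b) * t ^ (a / 2)) := by
    simp only [← Real.rpow_add ht]
    ring_nf
  have e4 : t ^ (-(1 - b - a / 2)) = t ^ b * (t⁻¹ * t ^ (a / 2)) := by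
    rw [← Real.rpow_neg_one]
    simp only [← Real.rpow_add ht]
    ring_nf
  rw [e1, e2, e3, e4]
  ring

/-- Local decay for the quartic KdV equation (`p = 4`):
`liminf_{t→∞} ∫_{Ω(t)} u(t,x)⁴ dx = 0` where `Ω(t) = {x : |x + ε₀ t^n| < t^b}`. -/
theorem kdv_quartic_liminf_decay
    (b n ε₀ : ℝ) (hb₁ : 0 < b) (hb₂ : b < 4/7) (hn₁ : 0 ≤ n) (hn₂ : n < 1 - b/2)
    (hε₀ : ε₀ = -1 ∨ ε₀ = 1)
    (u : ℝ → ℝ → ℝ) (hu : IsAdmissibleGKdV 4 u)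
    (hH1 : ∃ C : ℝ, ∀ t : ℝ, 2 ≤ t →
      Real.sqrt (∫ x : ℝ, (u t x)^2) + Real.sqrt (∫ x : ℝ, (px1 u t x)^2) ≤ C) :
    Filter.liminf
      (fun t : ℝ => ∫ x in {x : ℝ | |x + ε₀ * t ^ n| < t ^ b}, (u t x)^4)
      Filter.atTop = 0 := by
  obtain ⟨c⟩ := nonempty_cutoff
  obtain ⟨C, hC⟩ := hH1
  have hε : |ε₀| = 1 := by rcases hε₀ with rfl | rfl <;> simp
  have hsq : ∀ I J : ℝ, 0 ≤ I → √I + √J ≤ C → I ≤ C ^ 2 := fun I J hI h => by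
    have h1 := Real.sqrt_nonneg J
    have h2 := Real.sqrt_nonneg I
    nlinarith [Real.sq_sqrt hI]
  have h0 : ∀ t, 2 ≤ t → ∫ x, u t x ^ 2 ≤ C ^ 2 := fun t ht =>
    hsq _ _ (integral_nonneg fun x => sq_nonneg _) (hC t ht)
  have h1 : ∀ t, 2 ≤ t → ∫ x, px1 u t x ^ 2 ≤ C ^ 2 := fun t ht =>
    hsq _ _ (integral_nonneg fun x => sq_nonneg _) ((add_comm _ _).trans_le (hC t ht))
  obtain ⟨a, ha1, ha2⟩ : ∃ a, b < a ∧ a < min (2 * b) (min (2 - 2 * n) (2 - 2 * b)) :=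
    exists_between (lt_min (by linarith) (lt_min (by linarith) (by linarith)))
  obtain ⟨ha2, ha3, ha4⟩ := (lt_min_iff.1 ha2).imp id lt_min_iff.1
  set I : ℝ → ℝ := fun t => ∫ x in {x : ℝ | |x + ε₀ * t ^ n| < t ^ b}, u t x ^ 4 with hI
  have hI0 : ∀ t, 0 ≤ I t := fun t => integral_nonneg fun x => by positivity
  have hIB : ∀ᶠ t in atTop, I t ≤ 2 * C ^ 2 * C ^ 2 := by
    filter_upwards [eventually_ge_atTop 2] with t ht
    exact (setIntegral_le_integral (hu.integrable_pow_four ht)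
      (Eventually.of_forall fun x => by positivity)).trans
      (hu.integral_pow_four_le ht (h0 t ht) (h1 t ht))
  refine le_antisymm ?_ (le_liminf_of_le (isBoundedUnder_of_eventually_le hIB).isCoboundedUnder_ge
    (Eventually.of_forall hI0))
  by_contra! hpos
  obtain ⟨k, hk, hk2⟩ := exists_between hpos
  have hev := eventually_lt_of_lt_liminf hk2 (isBoundedUnder_of_eventually_ge
    (Eventually.of_forall hI0))
  refine not_eventually_hasDerivAt_ge (M := fun s => ∫ x, u s x * c.W ε₀ n b a s x) (k := k / 2)
    (p := a / 2) (q := 1 - b) (C := c.K * (2 + C ^ 2 / 2)) (by linarith) (by linarith)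
    (by linarith) ?_ ?_
  · filter_upwards [eventually_ge_atTop 2] with t ht
    rw [mul_assoc]
    exact abs_integral_mul_W_le hu c ht (h0 t ht)
  · filter_upwards [eventually_ge_atTop 2, hev, (tendsto_error c.K (C ^ 2) ha1 ha2 ha3
      ha4).eventually_lt_const (half_pos hk)] with t ht hkt herr
    have ht0 : 0 < t := by linarith
    obtain ⟨D, hD, hle⟩ := exists_hasDerivAt_integral_mul_W hu c hε ht hn₁ (by linarith) hb₁.le
      ha1.le (by linarith) (h0 t ht) (h1 t ht)
    refine ⟨D, hD, le_trans ?_ hle⟩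
    have p := Real.rpow_pos_of_pos ht0 (-b)
    have e : t ^ (1 - b - 1) = t ^ (-b) := by
      congr 1
      ring
    have e' : t ^ (-b) * t ^ b = 1 := by
      rw [← Real.rpow_add ht0]
      simp
    rw [e]
    have m1 := mul_lt_mul_of_pos_left herr p
    rw [← mul_assoc, e', one_mul] at m1
    have m2 := mul_lt_mul_of_pos_left hkt p
    simp only [hI] at m2
    linarith
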